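/- Let X be a compact Hausdorff space, Y ⊆ X a closed subset, and M a unital Banach C(X,ℂ)-module. Then the submodule I_Y • M (the C(X,ℂ)-linear span of {f • m : f ∈ I_Y, m ∈ M}) is closed in M. -/

import Mathlib

/-- The ideal of continuous functions vanishing on the subset `Y`. -/
noncomputable def IY {X : Type*} [TopologicalSpace X] (Y : Set X) : Ideal C(X, ℂ) where
  carrier := {f : C(X, ℂ) | ∀ y ∈ Y, f y = 0}
  add_mem' := by
    intro a b ha hb y hy
    simp [ha y hy, hb y hy]
  zero_mem' := by
    intro y hy
    simp
  smul_mem' := by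
    intro c f hf y hy
    simp [hf y hy]

/-- A real continuous function viewed as a complex continuous function. -/
noncomputable def complexify {X : Type*} [TopologicalSpace X] (v : C(X, ℝ)) : C(X, ℂ) :=
  ⟨fun x => (v x : ℂ), by fun_prop⟩

@[simp]
theorem complexify_apply {X : Type*} [TopologicalSpace X] (v : C(X, ℝ)) (x : X) :
    complexify v x = (v x : ℂ) := rfl

theorem norm_complexify_le {X : Type*} [TopologicalSpace X] [CompactSpace X] {v : C(X, ℝ)} {c : ℝ}
    (hc : 0 ≤ c) (h : ∀ x, 0 ≤ v x ∧ v x ≤ c) : ‖complexify v‖ ≤ c := by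
  refine (ContinuousMap.norm_le _ hc).2 fun x => ?_
  simpa [abs_of_nonneg (h x).1] using (h x).2

theorem continuous_complexify {X : Type*} [TopologicalSpace X] :
    Continuous (complexify : C(X, ℝ) → C(X, ℂ)) :=
  ContinuousMap.continuous_postcomp ⟨Complex.ofReal, Complex.continuous_ofReal⟩

/-- `v` takes values in `[0, 1]` and equals `1` on `Y`; equivalently, `1 - v` lies in the
positive part of the unit ball of the ideal of `Y`. -/
structure IsCoUnit {X : Type*} [TopologicalSpace X] (Y : Set X) (v : C(X, ℝ)) : Prop where
  nonneg : ∀ x, 0 ≤ v x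
  le_one : ∀ x, v x ≤ 1
  eq_one : ∀ y ∈ Y, v y = 1

theorem IsCoUnit.mul {X : Type*} [TopologicalSpace X] {Y : Set X} {v w : C(X, ℝ)}
    (hv : IsCoUnit Y v) (hw : IsCoUnit Y w) : IsCoUnit Y (v * w) where
  nonneg x := mul_nonneg (hv.nonneg x) (hw.nonneg x)
  le_one x := mul_le_one₀ (hv.le_one x) (hw.nonneg x) (hw.le_one x)
  eq_one y hy := by simp [hv.eq_one y hy, hw.eq_one y hy]

theorem IsCoUnit.norm_complexify_le_one {X : Type*} [TopologicalSpace X] [CompactSpace X]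
    {Y : Set X} {v : C(X, ℝ)} (hv : IsCoUnit Y v) : ‖complexify v‖ ≤ 1 :=
  norm_complexify_le zero_le_one fun x => ⟨hv.nonneg x, hv.le_one x⟩

theorem complexify_mul {X : Type*} [TopologicalSpace X] (v w : C(X, ℝ)) :
    complexify (v * w) = complexify v * complexify w := by
  ext x; simp

theorem complexify_sub {X : Type*} [TopologicalSpace X] (v w : C(X, ℝ)) :
    complexify (v - w) = complexify v - complexify w := by
  ext x; simp

theorem exists_isCoUnit_norm_mul_le {X : Type*} [TopologicalSpace X] [CompactSpace X]
    {Y : Set X} {f : C(X, ℂ)} (hf : f ∈ IY Y) {δ : ℝ} (hδ : 0 < δ) :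
    ∃ v, IsCoUnit Y v ∧ ‖complexify v * f‖ ≤ δ := by
  have hpos : ∀ x, 0 < δ + ‖f x‖ := fun x => by positivity
  refine ⟨⟨fun x => δ / (δ + ‖f x‖),
    continuous_const.div (by fun_prop) fun x => (hpos x).ne'⟩, ⟨?_, ?_, ?_⟩, ?_⟩
  · exact fun x => (div_pos hδ (hpos x)).le
  · exact fun x => (div_le_one (hpos x)).2 (by simp)
  · intro y hy
    have hfy : f y = 0 := hf y hy
    simp [hfy, hδ.ne']
  · refine (ContinuousMap.norm_le _ hδ.le).2 fun x => ?_
    have h : ‖δ / (δ + ‖f x‖)‖ = δ / (δ + ‖f x‖) :=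
      Real.norm_of_nonneg (div_pos hδ (hpos x)).le
    rw [ContinuousMap.mul_apply, norm_mul, complexify_apply, Complex.norm_real,
      ContinuousMap.coe_mk, h, div_mul_eq_mul_div, div_le_iff₀ (hpos x)]
    nlinarith

section BanachModule

variable {X M : Type*} [TopologicalSpace X] [CompactSpace X] [NormedAddCommGroup M]
  [Module C(X, ℂ) M] {Y : Set X}

theorem IsCoUnit.norm_smul_le (hnorm : ∀ (f : C(X, ℂ)) (m : M), ‖f • m‖ ≤ ‖f‖ * ‖m‖)
    {v : C(X, ℝ)} (hv : IsCoUnit Y v) (m : M) : ‖complexify v • m‖ ≤ ‖m‖ :=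
  (hnorm _ _).trans (mul_le_of_le_one_left (norm_nonneg m) hv.norm_complexify_le_one)

theorem exists_isCoUnit_norm_smul_lt (hnorm : ∀ (f : C(X, ℂ)) (m : M), ‖f • m‖ ≤ ‖f‖ * ‖m‖)
    {m : M} (hm : m ∈ IY Y • (⊤ : Submodule C(X, ℂ) M)) :
    ∀ ε > 0, ∃ v, IsCoUnit Y v ∧ ‖complexify v • m‖ < ε := by
  induction hm using Submodule.smul_induction_on' with
  | smul f hf m _ =>
    intro ε hε
    obtain ⟨v, hv, hvf⟩ := exists_isCoUnit_norm_mul_le hf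
      (show 0 < ε / (‖m‖ + 1) by positivity)
    refine ⟨v, hv, ?_⟩
    rw [smul_smul]
    calc ‖(complexify v * f) • m‖ ≤ ε / (‖m‖ + 1) * ‖m‖ :=
          (hnorm _ _).trans (mul_le_mul_of_nonneg_right hvf (norm_nonneg m))
      _ < ε := by
          rw [div_mul_eq_mul_div, div_lt_iff₀ (by positivity)]
          nlinarith
  | add m _ n _ ihm ihn =>
    intro ε hε
    obtain ⟨v, hv, hvm⟩ := ihm (ε / 2) (by positivity)
    obtain ⟨w, hw, hwn⟩ := ihn (ε / 2) (by positivity)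
    refine ⟨v * w, hv.mul hw, ?_⟩
    have h : complexify (v * w) • (m + n)
        = complexify w • complexify v • m + complexify v • complexify w • n := by
      rw [complexify_mul, smul_add, smul_smul, smul_smul, mul_comm (complexify w)]
    rw [h]
    linarith [norm_add_le (complexify w • complexify v • m) (complexify v • complexify w • n),
      hw.norm_smul_le hnorm (complexify v • m), hv.norm_smul_le hnorm (complexify w • n)]

theorem exists_isCoUnit_norm_smul_lt_of_mem_closure
    (hnorm : ∀ (f : C(X, ℂ)) (m : M), ‖f • m‖ ≤ ‖f‖ * ‖m‖) {m : M}
    (hm : m ∈ closure ((IY Y • (⊤ : Submodule C(X, ℂ) M) : Submodule C(X, ℂ) M) : Set M))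
    {ε : ℝ} (hε : 0 < ε) : ∃ v, IsCoUnit Y v ∧ ‖complexify v • m‖ < ε := by
  obtain ⟨n, hn, hmn⟩ := Metric.mem_closure_iff.1 hm (ε / 2) (by positivity)
  obtain ⟨v, hv, hvn⟩ := exists_isCoUnit_norm_smul_lt hnorm hn (ε / 2) (by positivity)
  refine ⟨v, hv, ?_⟩
  have h : complexify v • m = complexify v • (m - n) + complexify v • n := by
    rw [← smul_add, sub_add_cancel]
  rw [dist_eq_norm] at hmn
  rw [h]
  linarith [norm_add_le (complexify v • (m - n)) (complexify v • n),
    hv.norm_smul_le hnorm (m - n)]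

/-- Cohen's factorization: if `m` is approximated fast enough along a sequence of co-units,
it lies in the range of a single element of the ideal. -/
theorem exists_mem_IY_smul_eq [CompleteSpace M]
    (hnorm : ∀ (f : C(X, ℂ)) (m : M), ‖f • m‖ ≤ ‖f‖ * ‖m‖) {m : M} {v : ℕ → C(X, ℝ)}
    (hv : ∀ n, IsCoUnit Y (v n)) (hvm : ∀ n, ‖complexify (v n) • m‖ ≤ (1 / 4) ^ n) :
    ∃ g ∈ IY Y, ∃ x : M, g • x = m := by
  have : IsBoundedSMul C(X, ℂ) M := .of_norm_smul_le hnorm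
  let p : ℕ → C(X, ℝ) := fun k => ((1 / 2 : ℝ) ^ (k + 1)) • v k
  let G : ℕ → C(X, ℝ) := fun n => 1 - ∑ k ∈ Finset.range n, p k
  have hp : Summable p := by
    refine Summable.of_norm_bounded (g := fun k => (1 / 2 : ℝ) ^ (k + 1))
      ((summable_nat_add_iff 1).2 summable_geometric_two) fun k => ?_
    refine (ContinuousMap.norm_le _ (by positivity)).2 fun x => ?_
    have h0 := (hv k).nonneg x
    rw [Real.norm_of_nonneg (by simp only [p, ContinuousMap.smul_apply, smul_eq_mul]; positivity)]
    exact mul_le_of_le_one_right (by positivity) ((hv k).le_one x)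
  have hGsucc : ∀ n, G n - G (n + 1) = p n := fun n => by
    simp [G, Finset.sum_range_succ]
  have hGge : ∀ n x, (1 / 2 : ℝ) ^ n ≤ G n x := fun n x => by
    induction n with
    | zero => simp [G]
    | succ n ih =>
      have h := DFunLike.congr_fun (hGsucc n) x
      simp only [p, ContinuousMap.sub_apply, ContinuousMap.smul_apply, smul_eq_mul] at h
      have h1 := mul_le_of_le_one_right (show (0 : ℝ) ≤ (1 / 2) ^ (n + 1) by positivity)
        ((hv n).le_one x)
      have h2 : (1 / 2 : ℝ) ^ n = 2 * (1 / 2) ^ (n + 1) := by ring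
      linarith
  have hGpos : ∀ n x, 0 < G n x := fun n x => lt_of_lt_of_le (by positivity) (hGge n x)
  let R : ℕ → C(X, ℝ) := fun n =>
    ⟨fun x => (G n x)⁻¹, (G n).continuous.inv₀ fun x => (hGpos n x).ne'⟩
  have hR : ∀ n, ‖complexify (R n)‖ ≤ 2 ^ n := fun n =>
    norm_complexify_le (by positivity) fun x => by
      refine ⟨(inv_pos.2 (hGpos n x)).le, inv_le_of_inv_le₀ (by positivity) ?_⟩
      simpa using hGge n x
  have hGR : ∀ n, complexify (G n) * complexify (R n) = 1 := fun n => by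
    ext x
    simp [R, (hGpos n x).ne']
  have hdiff : ∀ n, complexify (R (n + 1)) - complexify (R n)
      = complexify (p n) * complexify (R n) * complexify (R (n + 1)) := fun n => by
    rw [← hGsucc, complexify_sub]
    linear_combination complexify (R n) * hGR (n + 1) - complexify (R (n + 1)) * hGR n
  have hpm : ∀ n, ‖complexify (p n) • m‖ ≤ (1 / 2) ^ (n + 1) * (1 / 4) ^ n := fun n => by
    let c : C(X, ℝ) := ContinuousMap.const X ((1 / 2 : ℝ) ^ (n + 1))
    have hc : ‖complexify c‖ ≤ (1 / 2) ^ (n + 1) :=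
      norm_complexify_le (by positivity) fun x => ⟨by simp [c], le_rfl⟩
    have hpc : p n = c * v n := by ext x; simp [p, c]
    rw [hpc, complexify_mul, mul_smul]
    exact (hnorm _ _).trans (mul_le_mul hc (hvm n) (norm_nonneg _) (by positivity))
  have hcauchy : CauchySeq fun n => complexify (R n) • m := by
    refine cauchySeq_of_le_geometric (1 / 2) 1 (by norm_num) fun n => ?_
    rw [dist_comm, dist_eq_norm, ← sub_smul, hdiff, mul_assoc, mul_comm, mul_smul, mul_smul]
    calc _ ≤ 2 ^ n * (2 ^ (n + 1) * ((1 / 2) ^ (n + 1) * (1 / 4 : ℝ) ^ n)) := by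
          refine (hnorm _ _).trans (mul_le_mul (hR n) ?_ (norm_nonneg _) (by positivity))
          exact (hnorm _ _).trans
            (mul_le_mul (hR (n + 1)) (hpm n) (norm_nonneg _) (by positivity))
      _ = 1 * (1 / 2) ^ n := by
          rw [← mul_assoc (2 ^ (n + 1)), ← mul_pow, mul_comm, mul_assoc, ← mul_pow]
          norm_num [← mul_pow]
  obtain ⟨x, hx⟩ := cauchySeq_tendsto_of_complete hcauchy
  have hG : Filter.Tendsto (fun n => complexify (G n)) Filter.atTop
      (nhds (complexify (1 - ∑' k, p k))) :=
    (continuous_complexify.tendsto _).comp (hp.hasSum.tendsto_sum_nat.const_sub 1)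
  refine ⟨complexify (1 - ∑' k, p k), fun y hy => ?_, x, ?_⟩
  · have h : (∑' k, p k) y = 1 := by
      rw [← ContinuousMap.tsum_apply hp]
      simp only [p, ContinuousMap.smul_apply, (hv _).eq_one y hy, smul_eq_mul, mul_one, pow_succ]
      rw [tsum_mul_right, tsum_geometric_two]
      norm_num
    simp [h]
  · refine tendsto_nhds_unique (hG.smul hx) ?_
    simp [smul_smul, hGR]

end BanachModule

/-- For a closed subset `Y` of a compact Hausdorff space `X` and a unital
Banach `C(X,ℂ)`-module `M`, the submodule `I_Y • M` is closed in `M`. -/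
theorem stmt16 {X M : Type*} [TopologicalSpace X] [CompactSpace X] [T2Space X]
    [NormedAddCommGroup M] [CompleteSpace M] [Module C(X, ℂ) M]
    (hnorm : ∀ (f : C(X, ℂ)) (m : M), ‖f • m‖ ≤ ‖f‖ * ‖m‖)
    (Y : Set X) (hY : IsClosed Y) :
    IsClosed ((IY Y • (⊤ : Submodule C(X, ℂ) M) : Submodule C(X, ℂ) M) : Set M) := by
  refine isClosed_of_closure_subset fun m hm => ?_
  choose v hv hvm using fun n : ℕ => exists_isCoUnit_norm_smul_lt_of_mem_closure hnorm hm
    (show (0 : ℝ) < (1 / 4) ^ n by positivity)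
  obtain ⟨g, hg, x, rfl⟩ := exists_mem_IY_smul_eq hnorm hv fun n => (hvm n).le
  exact Submodule.smul_mem_smul hg Submodule.mem_top
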